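/- Assume q_0 has finite fourth moment. Then for every t > 0 and every x ∈ ℝ^d, the fourth derivative tensor of log q_t satisfies ∇_x⁴ log q_t(x) = (λ_t⁴/σ_t⁸) ( E_{t,x}[ (θ − m(t, x))^{⊗4} ] − T( C_t(x)^{⊗2} ) ), where for a tensor X ∈ ℝ^{d×d×d×d}, T(X) = (1/8) Σ_{π ∈ perm(4)} T_π(X) with T_π(X)_{i₁ i₂ i₃ i₄} = X_{i_{π(1)} i_{π(2)} i_{π(3)} i_{π(4)}}; equivalently, T(C_t(x)^{⊗2})_{i₁ i₂ i₃ i₄} = C_t(x)_{i₁ i₂} C_t(x)_{i₃ i₄} + C_t(x)_{i₁ i₃} C_t(x)_{i₂ i₄} + C_t(x)_{i₁ i₄} C_t(x)_{i₂ i₃}. -/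

import Mathlib

open MeasureTheory ProbabilityTheory Real
open scoped RealInnerProductSpace

noncomputable section

abbrev Vec (d : ℕ) := EuclideanSpace ℝ (Fin d)

def stdGaussian (d : ℕ) : Measure (Vec d) :=
  Measure.map (⇑(EuclideanSpace.equiv (Fin d) ℝ).symm)
    (Measure.pi fun _ : Fin d => gaussianReal 0 1)

/-- The law `q_u` of `e^{-u} θ + √(1 - e^{-2u}) g`, with `θ ~ q0` and `g ~ N(0, I_d)`
independent. -/
def forwardLaw {d : ℕ} (q0 : Measure (Vec d)) (u : ℝ) : Measure (Vec d) :=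
  Measure.map (fun p : Vec d × Vec d =>
      Real.exp (-u) • p.1 + Real.sqrt (1 - Real.exp (-2*u)) • p.2)
    (q0.prod (stdGaussian d))

/-- Gaussian weight `exp(-‖x - λ_t θ‖² / (2σ_t²))`. -/
def weight {d : ℕ} (t : ℝ) (x θ : Vec d) : ℝ :=
  Real.exp (-‖x - Real.exp (-t) • θ‖^2 / (2 * (1 - Real.exp (-2*t))))

/-- The conditional law `μ_{t,x}` of `θ` given `λ_t θ + σ_t g = x`:
`dμ_{t,x}(θ) = Z_{t,x}⁻¹ exp(-‖x - λ_t θ‖²/(2σ_t²)) dq0(θ)`. -/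
def condMeasure {d : ℕ} (q0 : Measure (Vec d)) (t : ℝ) (x : Vec d) : Measure (Vec d) :=
  (∫⁻ θ, ENNReal.ofReal (weight t x θ) ∂q0)⁻¹ •
    q0.withDensity fun θ => ENNReal.ofReal (weight t x θ)

/-- The conditional mean `m(t, x) = E_{t,x}[θ]`. -/
def condMean {d : ℕ} (q0 : Measure (Vec d)) (t : ℝ) (x : Vec d) : Vec d :=
  ∫ θ, θ ∂(condMeasure q0 t x)

/-- Partial derivative in the `i`-th coordinate direction. -/
def pd {d : ℕ} (i : Fin d) (f : Vec d → ℝ) (x : Vec d) : ℝ :=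
  fderiv ℝ f x (EuclideanSpace.single i 1)

/-- A product of absolutely continuous measures on `ℝ` has the product density. -/
theorem pi_withDensity_ofReal {ι : Type*} [Fintype ι] (f : ι → ℝ → ℝ)
    (hf : ∀ i, Integrable (f i)) (hf0 : ∀ i y, 0 ≤ f i y) :
    Measure.pi (fun i => volume.withDensity fun y => ENNReal.ofReal (f i y)) =
      (volume : Measure (ι → ℝ)).withDensity fun y => ENNReal.ofReal (∏ i, f i (y i)) := by
  have : ∀ i, IsFiniteMeasure (volume.withDensity fun y => ENNReal.ofReal (f i y)) :=
    fun i => isFiniteMeasure_withDensity_ofReal (hf i).2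
  refine Measure.pi_eq fun s hs => ?_
  have hind : ∀ y : ι → ℝ, (Set.univ.pi s).indicator (fun y => ∏ i, f i (y i)) y =
      ∏ i, (s i).indicator (f i) (y i) := by
    intro y
    by_cases hy : y ∈ Set.univ.pi s
    · rw [Set.indicator_of_mem hy]
      exact Finset.prod_congr rfl fun i _ => (Set.indicator_of_mem (hy i trivial) _).symm
    · rw [Set.indicator_of_notMem hy]
      obtain ⟨i, hi⟩ : ∃ i, y i ∉ s i := by simpa [Set.mem_pi] using hy
      exact (Finset.prod_eq_zero (Finset.mem_univ i) (Set.indicator_of_notMem hi _)).symm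
  have hsm : MeasurableSet (Set.univ.pi s) := MeasurableSet.univ_pi hs
  have hint : Integrable fun y : ι → ℝ => ∏ i, f i (y i) := Integrable.fintype_prod hf
  rw [withDensity_apply _ hsm,
    ← ofReal_integral_eq_lintegral_ofReal hint.integrableOn
      (Filter.Eventually.of_forall fun y => Finset.prod_nonneg fun i _ => hf0 i _),
    ← integral_indicator hsm]
  simp_rw [hind]
  rw [integral_fintype_prod_volume_eq_prod (fun i => (s i).indicator (f i)),
    ENNReal.ofReal_prod_of_nonneg
      fun i _ => integral_nonneg fun y => Set.indicator_nonneg (fun y _ => hf0 i y) y]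
  refine Finset.prod_congr rfl fun i _ => ?_
  rw [withDensity_apply _ (hs i),
    ← ofReal_integral_eq_lintegral_ofReal (hf i).integrableOn
      (Filter.Eventually.of_forall fun y => hf0 i y),
    ← integral_indicator (hs i)]

/-- The variance `1 - e^{-2t}` is positive for `t > 0`. -/
theorem one_sub_exp_pos {t : ℝ} (ht : 0 < t) : 0 < 1 - Real.exp (-2 * t) := by
  rw [sub_pos, Real.exp_lt_one_iff]
  linarith

theorem prod_gaussianPDFReal {d : ℕ} {t : ℝ} (ht : 0 < t) (θ y : Vec d) :
    ∏ i, gaussianPDFReal (Real.exp (-t) * θ i) (1 - Real.exp (-2 * t)).toNNReal (y i) =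
      (√(2 * π * (1 - Real.exp (-2 * t))))⁻¹ ^ d * weight t y θ := by
  have hs := one_sub_exp_pos ht
  simp only [gaussianPDFReal, Real.coe_toNNReal _ hs.le, Finset.prod_mul_distrib,
    Finset.prod_const, Finset.card_univ, Fintype.card_fin, ← Real.exp_sum, weight]
  rw [← Finset.sum_div, Finset.sum_neg_distrib, EuclideanSpace.norm_sq_eq]
  simp

/-- The affine image `e^{-t} θ + √(1 - e^{-2t}) g` of a standard Gaussian has density proportional
to `weight t · θ`. -/
theorem map_affine_stdGaussian {d : ℕ} {t : ℝ} (ht : 0 < t) (θ : Vec d) :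
    (_root_.stdGaussian d).map
        (fun g => Real.exp (-t) • θ + Real.sqrt (1 - Real.exp (-2 * t)) • g) =
      volume.withDensity fun y =>
        ENNReal.ofReal ((√(2 * π * (1 - Real.exp (-2 * t))))⁻¹ ^ d * weight t y θ) := by
  have hs := one_sub_exp_pos ht
  have hv : (1 - Real.exp (-2 * t)).toNNReal ≠ 0 := by simpa using hs
  have h1 : ∀ i : Fin d, (gaussianReal 0 1).map
      (fun y => Real.exp (-t) * θ i + Real.sqrt (1 - Real.exp (-2 * t)) * y) =
      gaussianReal (Real.exp (-t) * θ i) (1 - Real.exp (-2 * t)).toNNReal := by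
    intro i
    have := gaussianReal_map_const_mul (μ := 0) (v := 1) (Real.sqrt (1 - Real.exp (-2 * t)))
    have hc : (fun y => Real.exp (-t) * θ i + Real.sqrt (1 - Real.exp (-2 * t)) * y) =
      (fun y => Real.exp (-t) * θ i + y) ∘ (fun y => Real.sqrt (1 - Real.exp (-2 * t)) * y) := rfl
    rw [hc, ← Measure.map_map (by fun_prop) (by fun_prop), this, gaussianReal_map_const_add]
    congr 1
    · simp
    · ext
      rw [mul_one, NNReal.coe_mk, Real.sq_sqrt hs.le, Real.coe_toNNReal _ hs.le]
  rw [_root_.stdGaussian, Measure.map_map (by fun_prop) (by fun_prop)]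
  have hcomp : (fun g : Vec d => Real.exp (-t) • θ + Real.sqrt (1 - Real.exp (-2 * t)) • g) ∘
      ⇑(EuclideanSpace.equiv (Fin d) ℝ).symm =
      ⇑(MeasurableEquiv.toLp 2 (Fin d → ℝ)) ∘ (fun y i =>
        Real.exp (-t) * θ i + Real.sqrt (1 - Real.exp (-2 * t)) * y i) := by
    ext y i
    simp
  have hmp := PiLp.volume_preserving_toLp (Fin d)
  rw [hcomp, ← Measure.map_map (by fun_prop) (by fun_prop)]
  rw [Measure.pi_map_pi (f := fun i y => Real.exp (-t) * θ i +
    Real.sqrt (1 - Real.exp (-2 * t)) * y) (fun i => by fun_prop)]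
  simp_rw [h1, gaussianReal_of_var_ne_zero _ hv, gaussianPDF_def]
  rw [pi_withDensity_ofReal _ (fun i => integrable_gaussianPDFReal _ _)
    (fun i y => gaussianPDFReal_nonneg _ _ y)]
  ext s hs
  rw [Measure.map_apply (by fun_prop) hs, withDensity_apply _ hs,
    withDensity_apply _ (hs.preimage (by fun_prop)),
    ← hmp.setLIntegral_comp_preimage_emb (MeasurableEquiv.toLp 2 _).measurableEmbedding]
  refine setLIntegral_congr_fun (hs.preimage (by fun_prop)) fun y _ => ?_
  simp only [← prod_gaussianPDFReal ht]

theorem continuous_weight {d : ℕ} (t : ℝ) :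
    Continuous fun p : Vec d × Vec d => weight t p.1 p.2 := by
  unfold weight
  fun_prop

theorem weight_pos {d : ℕ} (t : ℝ) (x θ : Vec d) : 0 < weight t x θ := Real.exp_pos _

theorem weight_le_one {d : ℕ} {t : ℝ} (ht : 0 < t) (x θ : Vec d) : weight t x θ ≤ 1 := by
  have hs := one_sub_exp_pos ht
  rw [weight, Real.exp_le_one_iff, neg_div, neg_nonpos]
  positivity

theorem integrable_weight {d : ℕ} {t : ℝ} (ht : 0 < t) (x : Vec d) (q0 : Measure (Vec d))
    [IsFiniteMeasure q0] : Integrable (weight t x) q0 := by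
  have hc : Continuous (weight t x) := by
    unfold weight
    fun_prop
  refine Integrable.of_bound hc.aestronglyMeasurable 1 (Filter.Eventually.of_forall fun θ => ?_)
  rw [Real.norm_of_nonneg (weight_pos t x θ).le]
  exact weight_le_one ht x θ

/-- The density of `forwardLaw q0 t` is proportional to the normalizing constant `Z_{t,x}`. -/
theorem density_eq_integral_weight {d : ℕ} (q0 : Measure (Vec d)) [IsProbabilityMeasure q0]
    {t : ℝ} (ht : 0 < t) {f : Vec d → ℝ} (hf0 : ∀ y, 0 < f y) (hfc : Continuous f)
    (hf : forwardLaw q0 t = volume.withDensity fun y => ENNReal.ofReal (f y)) (y : Vec d) :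
    f y = (√(2 * π * (1 - Real.exp (-2 * t))))⁻¹ ^ d * ∫ θ, weight t y θ ∂q0 := by
  set c := (√(2 * π * (1 - Real.exp (-2 * t))))⁻¹ ^ d with hc
  have hc0 : 0 ≤ c := by positivity
  have hZ0 : ∀ y, 0 ≤ c * ∫ θ, weight t y θ ∂q0 := fun y =>
    mul_nonneg hc0 (integral_nonneg fun θ => (weight_pos t y θ).le)
  have hZc : Continuous fun y => c * ∫ θ, weight t y θ ∂q0 := by
    refine continuous_const.mul (continuous_of_dominated (bound := fun _ => 1) ?_ ?_ ?_ ?_)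
    · exact fun y => (integrable_weight ht y q0).1
    · refine fun y => Filter.Eventually.of_forall fun θ => ?_
      rw [Real.norm_of_nonneg (weight_pos t y θ).le]
      exact weight_le_one ht y θ
    · exact integrable_const _
    · refine Filter.Eventually.of_forall fun θ => ?_
      unfold weight
      fun_prop
  have hw : Measurable fun p : Vec d × Vec d => ENNReal.ofReal (c * weight t p.1 p.2) :=
    ((continuous_weight t).measurable.const_mul c).ennreal_ofReal
  have hprob : IsProbabilityMeasure (_root_.stdGaussian d) := by
    unfold _root_.stdGaussian
    exact Measure.isProbabilityMeasure_map (by fun_prop)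
  have hlaw : forwardLaw q0 t =
      volume.withDensity fun y => ENNReal.ofReal (c * ∫ θ, weight t y θ ∂q0) := by
    ext s hs
    have hm : Measurable fun p : Vec d × Vec d =>
        Real.exp (-t) • p.1 + Real.sqrt (1 - Real.exp (-2 * t)) • p.2 := by fun_prop
    rw [forwardLaw, Measure.map_apply hm hs, Measure.prod_apply (hm hs), withDensity_apply _ hs]
    have h1 : ∀ θ : Vec d, _root_.stdGaussian d (Prod.mk θ ⁻¹' ((fun p : Vec d × Vec d =>
        Real.exp (-t) • p.1 + Real.sqrt (1 - Real.exp (-2 * t)) • p.2) ⁻¹' s)) =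
        ∫⁻ y in s, ENNReal.ofReal (c * weight t y θ) := by
      intro θ
      rw [hc, ← withDensity_apply _ hs, ← map_affine_stdGaussian ht θ,
        Measure.map_apply (by fun_prop) hs]
      rfl
    simp_rw [h1]
    rw [lintegral_lintegral_swap (f := fun θ y => ENNReal.ofReal (c * weight t y θ))
      (hw.comp measurable_swap).aemeasurable]
    refine lintegral_congr fun y => ?_
    rw [← integral_const_mul, ofReal_integral_eq_lintegral_ofReal]
    · exact (integrable_weight ht y q0).const_mul c
    · exact Filter.Eventually.of_forall fun θ => mul_nonneg hc0 (weight_pos t y θ).le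
  rw [hlaw, withDensity_eq_iff_of_sigmaFinite hZc.measurable.ennreal_ofReal.aemeasurable
    hfc.measurable.ennreal_ofReal.aemeasurable] at hf
  have hae : f =ᵐ[volume] fun y => c * ∫ θ, weight t y θ ∂q0 := by
    filter_upwards [hf] with y hy
    exact ((ENNReal.ofReal_eq_ofReal_iff (hZ0 y) (hf0 y).le).1 hy).symm
  exact congrFun ((hfc.ae_eq_iff_eq volume hZc).1 hae) y

/-- The function is differentiable at the point, with the given partial derivative there. -/
def HasPD {d : ℕ} (i : Fin d) (f : Vec d → ℝ) (f' : ℝ) (y : Vec d) : Prop :=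
  DifferentiableAt ℝ f y ∧ pd i f y = f'

namespace HasPD

variable {d : ℕ} {i : Fin d} {f g : Vec d → ℝ} {f' g' : ℝ} {y : Vec d}

theorem const (c : ℝ) : HasPD i (fun _ => c) 0 y :=
  ⟨differentiableAt_const c, by simp [pd]⟩

theorem add (hf : HasPD i f f' y) (hg : HasPD i g g' y) :
    HasPD i (fun y => f y + g y) (f' + g') y :=
  ⟨hf.1.add hg.1, by rw [pd, fderiv_fun_add hf.1 hg.1, ← hf.2, ← hg.2]; rfl⟩

theorem sub (hf : HasPD i f f' y) (hg : HasPD i g g' y) :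
    HasPD i (fun y => f y - g y) (f' - g') y :=
  ⟨hf.1.sub hg.1, by rw [pd, fderiv_fun_sub hf.1 hg.1, ← hf.2, ← hg.2]; rfl⟩

theorem mul (hf : HasPD i f f' y) (hg : HasPD i g g' y) :
    HasPD i (fun y => f y * g y) (f' * g y + f y * g') y := by
  refine ⟨hf.1.mul hg.1, ?_⟩
  rw [pd, fderiv_fun_mul hf.1 hg.1, ← hf.2, ← hg.2]
  simp only [pd, add_apply, smul_apply, smul_eq_mul]
  ring

theorem inv (hf : HasPD i f f' y) (h0 : f y ≠ 0) :
    HasPD i (fun y => (f y)⁻¹) (-(f' / f y ^ 2)) y := by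
  have h := (hasDerivAt_inv h0).comp_hasFDerivAt y hf.1.hasFDerivAt
  refine ⟨h.differentiableAt, ?_⟩
  rw [pd, ← hf.2]
  refine (congrArg (fun L : Vec d →L[ℝ] ℝ => L (EuclideanSpace.single i 1)) h.fderiv).trans ?_
  simp only [pd, smul_apply, smul_eq_mul]
  ring

theorem log (hf : HasPD i f f' y) (h0 : f y ≠ 0) :
    HasPD i (fun y => Real.log (f y)) (f' / f y) y := by
  have h := hf.1.hasFDerivAt.log h0
  refine ⟨h.differentiableAt, ?_⟩
  rw [pd, ← hf.2, h.fderiv]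
  simp only [pd, smul_apply, smul_eq_mul]
  ring

theorem inner_const (v : Vec d) : HasPD i (fun y => ⟪v, y⟫) (v i) y := by
  have h : HasFDerivAt (fun y : Vec d => ⟪v, y⟫) (innerSL ℝ v) y := (innerSL ℝ v).hasFDerivAt
  refine ⟨h.differentiableAt, ?_⟩
  rw [pd, h.fderiv]
  simp [EuclideanSpace.inner_single_right]

theorem norm_sq : HasPD i (fun y => ‖y‖ ^ 2) (2 * y i) y := by
  have h := (hasStrictFDerivAt_norm_sq y).hasFDerivAt
  refine ⟨h.differentiableAt, ?_⟩
  rw [pd, h.fderiv]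
  simp [EuclideanSpace.inner_single_right]

theorem coord (j : Fin d) :
    HasPD i (fun y => y j) ((EuclideanSpace.single i (1 : ℝ) : Vec d) j) y := by
  have h := (EuclideanSpace.proj j : Vec d →L[ℝ] ℝ).hasFDerivAt (x := y)
  refine ⟨h.differentiableAt, ?_⟩
  exact congrArg (fun L : Vec d →L[ℝ] ℝ => L (EuclideanSpace.single i 1)) h.fderiv

end HasPD

/-- The monomial `∏_{i ∈ l} z_i`. -/
def monomialAt {d : ℕ} (l : List (Fin d)) (z : Vec d) : ℝ := (l.map fun i => z i).prod

theorem continuous_monomialAt {d : ℕ} (l : List (Fin d)) : Continuous (monomialAt l) := by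
  induction l with
  | nil => exact continuous_const
  | cons i l ih =>
    have h : monomialAt (i :: l) = fun z => z i * monomialAt l z := by
      ext z
      simp [monomialAt]
    rw [h]
    fun_prop

theorem norm_le_exp_norm {d : ℕ} (z : Vec d) : ‖z‖ ≤ Real.exp ‖z‖ :=
  (le_add_of_nonneg_right zero_le_one).trans (Real.add_one_le_exp _)

theorem abs_monomialAt_le {d : ℕ} (l : List (Fin d)) (z : Vec d) :
    |monomialAt l z| ≤ Real.exp (l.length * ‖z‖) := by
  induction l with
  | nil => simp [monomialAt]
  | cons i l ih =>
    have h : monomialAt (i :: l) z = z i * monomialAt l z := by simp [monomialAt]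
    have hz : |z i| ≤ Real.exp ‖z‖ := (PiLp.norm_apply_le z i).trans (norm_le_exp_norm z)
    rw [h, abs_mul, List.length_cons, Nat.cast_add, Nat.cast_one, add_mul, one_mul, add_comm,
      Real.exp_add]
    exact mul_le_mul hz ih (abs_nonneg _) (Real.exp_pos _).le

/-- The moments `∫ ∏_{i ∈ l} z_i e^{⟨y - x, z⟩} dν(z)` of an exponentially tilted measure. -/
def tiltedMoment {d : ℕ} (ν : Measure (Vec d)) (x : Vec d) (l : List (Fin d)) (y : Vec d) : ℝ :=
  ∫ z, monomialAt l z * Real.exp ⟪y - x, z⟫ ∂ν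

section TiltedMoment

variable {d : ℕ} {ν : Measure (Vec d)}

theorem integrable_monomialAt_mul_exp (hν : ∀ R : ℝ, Integrable (fun z => Real.exp (R * ‖z‖)) ν)
    (l : List (Fin d)) (v : Vec d) :
    Integrable (fun z => monomialAt l z * Real.exp ⟪v, z⟫) ν := by
  have hc := continuous_monomialAt l
  refine (hν (l.length + ‖v‖)).mono' (by fun_prop) (Filter.Eventually.of_forall fun z => ?_)
  rw [norm_mul, Real.norm_eq_abs, Real.norm_of_nonneg (Real.exp_pos _).le, add_mul, Real.exp_add]
  gcongr
  · exact abs_monomialAt_le l z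
  · exact real_inner_le_norm v z

theorem hasPD_tiltedMoment (hν : ∀ R : ℝ, Integrable (fun z => Real.exp (R * ‖z‖)) ν)
    (x : Vec d) (l : List (Fin d)) (i : Fin d) (y : Vec d) :
    HasPD i (tiltedMoment ν x l) (tiltedMoment ν x (i :: l) y) y := by
  have hc := continuous_monomialAt l
  let F' : Vec d → Vec d → Vec d →L[ℝ] ℝ := fun y z =>
    (monomialAt l z * Real.exp ⟪y - x, z⟫) • innerSL ℝ z
  have hF'c : Continuous (F' y) := by
    have : Continuous fun z : Vec d => innerSL ℝ z := (innerSL ℝ).continuous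
    fun_prop
  have hbound : ∀ z, ∀ y' ∈ Metric.ball y 1,
      ‖F' y' z‖ ≤ Real.exp ((l.length + (‖y - x‖ + 1) + 1) * ‖z‖) := by
    intro z y' hy'
    have hyx : ‖y' - x‖ ≤ ‖y - x‖ + 1 := by
      have h1 : ‖y' - y‖ < 1 := by simpa [dist_eq_norm] using hy'
      calc ‖y' - x‖ = ‖(y - x) + (y' - y)‖ := by congr 1; abel
        _ ≤ ‖y - x‖ + ‖y' - y‖ := norm_add_le _ _
        _ ≤ _ := by linarith
    rw [norm_smul, norm_mul, Real.norm_eq_abs, Real.norm_of_nonneg (Real.exp_pos _).le,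
      innerSL_apply_norm, add_mul, add_mul, one_mul, Real.exp_add, Real.exp_add]
    gcongr
    · exact abs_monomialAt_le l z
    · exact (real_inner_le_norm _ z).trans (by gcongr)
    · exact norm_le_exp_norm z
  have hF'i : Integrable (F' y) ν :=
    (hν _).mono' hF'c.aestronglyMeasurable
      (Filter.Eventually.of_forall fun z => hbound z y (Metric.mem_ball_self one_pos))
  have h : HasFDerivAt (tiltedMoment ν x l) (∫ z, F' y z ∂ν) y := by
    refine hasFDerivAt_integral_of_dominated_of_fderiv_le (Metric.ball_mem_nhds y one_pos)
      (Filter.Eventually.of_forall fun y' => (integrable_monomialAt_mul_exp hν l (y' - x)).1)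
      (integrable_monomialAt_mul_exp hν l (y - x)) hF'c.aestronglyMeasurable
      (Filter.Eventually.of_forall hbound) (hν _)
      (Filter.Eventually.of_forall fun z y' _ => ?_)
    have hin : HasFDerivAt (fun y' : Vec d => ⟪y' - x, z⟫) (innerSL ℝ z) y' := by
      have h := ((innerSL ℝ z).hasFDerivAt (x := y' - x)).comp y' ((hasFDerivAt_id y').sub_const x)
      refine (h.congr_of_eventuallyEq (Filter.Eventually.of_forall fun w => ?_))
      simp [real_inner_comm]
    have hprod := hin.exp.const_mul (monomialAt l z)
    rwa [smul_smul] at hprod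
  refine ⟨h.differentiableAt, ?_⟩
  rw [pd, h.fderiv, ContinuousLinearMap.integral_apply hF'i, tiltedMoment]
  refine integral_congr_ae (Filter.Eventually.of_forall fun z => ?_)
  simp [F', monomialAt, EuclideanSpace.inner_single_right]
  ring

theorem tiltedMoment_nil_pos [NeZero ν]
    (hν : ∀ R : ℝ, Integrable (fun z => Real.exp (R * ‖z‖)) ν) (x y : Vec d) :
    0 < tiltedMoment ν x [] y := by
  have h : tiltedMoment ν x [] y = ∫ z, Real.exp ⟪y - x, z⟫ ∂ν := by
    simp [tiltedMoment, monomialAt]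
  rw [h]
  refine integral_exp_pos ?_
  simpa [monomialAt] using integrable_monomialAt_mul_exp hν [] (y - x)

/-- The normalized moments of the exponentially tilted measure. -/
def tiltedMean (ν : Measure (Vec d)) (x : Vec d) (l : List (Fin d)) (y : Vec d) : ℝ :=
  tiltedMoment ν x l y * (tiltedMoment ν x [] y)⁻¹

theorem hasPD_tiltedMean [NeZero ν] (hν : ∀ R : ℝ, Integrable (fun z => Real.exp (R * ‖z‖)) ν)
    (x : Vec d) (l : List (Fin d)) (i : Fin d) (y : Vec d) :
    HasPD i (tiltedMean ν x l)
      (tiltedMean ν x (i :: l) y - tiltedMean ν x [i] y * tiltedMean ν x l y) y := by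
  have h0 := (tiltedMoment_nil_pos hν x y).ne'
  have h := (hasPD_tiltedMoment hν x l i y).mul ((hasPD_tiltedMoment hν x [] i y).inv h0)
  refine ⟨h.1, h.2.trans ?_⟩
  simp only [tiltedMean]
  field_simp
  ring

theorem tiltedMean_self [IsProbabilityMeasure ν] (x : Vec d) (l : List (Fin d)) :
    tiltedMean ν x l x = ∫ z, monomialAt l z ∂ν := by
  simp [tiltedMean, tiltedMoment, monomialAt]

/-- The fourth derivative of the cumulant generating function of a centered probability measure
with all exponential moments, perturbed by a quadratic polynomial. -/
theorem pd_four_log_tiltedMoment [IsProbabilityMeasure ν]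
    (hν : ∀ R : ℝ, Integrable (fun z => Real.exp (R * ‖z‖)) ν)
    (hmean : ∀ i, ∫ z, z i ∂ν = 0) (x v : Vec d) (c κ : ℝ) (i j k l : Fin d) :
    pd i (pd j (pd k (pd l fun y =>
        c + ⟪v, y⟫ - κ * ‖y‖ ^ 2 + Real.log (tiltedMoment ν x [] y)))) x =
      (∫ z, z i * z j * z k * z l ∂ν) - ((∫ z, z i * z j ∂ν) * (∫ z, z k * z l ∂ν)
        + (∫ z, z i * z k ∂ν) * (∫ z, z j * z l ∂ν)
        + (∫ z, z i * z l ∂ν) * (∫ z, z j * z k ∂ν)) := by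
  have hE := hasPD_tiltedMean hν x
  have h1 : (pd l fun y => c + ⟪v, y⟫ - κ * ‖y‖ ^ 2 + Real.log (tiltedMoment ν x [] y)) =
      fun y => v l - (2 * κ) * y l + tiltedMean ν x [l] y := by
    ext y
    rw [((((HasPD.const c).add (HasPD.inner_const v)).sub
      ((HasPD.const κ).mul HasPD.norm_sq)).add
      ((hasPD_tiltedMoment hν x [] l y).log (tiltedMoment_nil_pos hν x y).ne')).2, tiltedMean]
    ring
  have h2 : (pd k fun y => v l - (2 * κ) * y l + tiltedMean ν x [l] y) =
      fun y => -(2 * κ) * (EuclideanSpace.single k (1 : ℝ) : Vec d) l +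
        (tiltedMean ν x [k, l] y - tiltedMean ν x [k] y * tiltedMean ν x [l] y) := by
    ext y
    rw [(((HasPD.const (v l)).sub ((HasPD.const (2 * κ)).mul (HasPD.coord l))).add
      (hE [l] k y)).2]
    ring
  have h3 : (pd j fun y => -(2 * κ) * (EuclideanSpace.single k (1 : ℝ) : Vec d) l +
        (tiltedMean ν x [k, l] y - tiltedMean ν x [k] y * tiltedMean ν x [l] y)) =
      fun y => tiltedMean ν x [j, k, l] y - tiltedMean ν x [j] y * tiltedMean ν x [k, l] y -
        ((tiltedMean ν x [j, k] y - tiltedMean ν x [j] y * tiltedMean ν x [k] y) *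
            tiltedMean ν x [l] y +
          tiltedMean ν x [k] y *
            (tiltedMean ν x [j, l] y - tiltedMean ν x [j] y * tiltedMean ν x [l] y)) := by
    ext y
    rw [((HasPD.const _).add ((hE [k, l] j y).sub ((hE [k] j y).mul (hE [l] j y)))).2]
    ring
  have hz : ∀ i, tiltedMean ν x [i] x = 0 := fun i => by
    rw [tiltedMean_self, ← hmean i]
    simp [monomialAt]
  rw [h1, h2, h3, (((hE [j, k, l] i x).sub ((hE [j] i x).mul (hE [k, l] i x))).sub
    ((((hE [j, k] i x).sub ((hE [j] i x).mul (hE [k] i x))).mul (hE [l] i x)).add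
      ((hE [k] i x).mul ((hE [j, l] i x).sub ((hE [j] i x).mul (hE [l] i x)))))).2]
  simp only [hz, tiltedMean_self]
  simp only [monomialAt, List.map_cons, List.map_nil, List.prod_cons, List.prod_nil, mul_one,
    ← mul_assoc]
  ring

end TiltedMoment

section CondMeasure

variable {d : ℕ} {q0 : Measure (Vec d)} {t : ℝ}

theorem measurable_ofReal_weight (t : ℝ) (x : Vec d) :
    Measurable fun θ => ENNReal.ofReal (weight t x θ) := by
  unfold weight
  fun_prop

/-- The conditional law of `(e^{-t} / (1 - e^{-2t})) (θ - m(t, x))`. -/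
def centeredLaw (q0 : Measure (Vec d)) (t : ℝ) (x : Vec d) : Measure (Vec d) :=
  (condMeasure q0 t x).map fun θ =>
    (Real.exp (-t) / (1 - Real.exp (-2 * t))) • (θ - condMean q0 t x)

theorem integral_centeredLaw (x : Vec d) {f : Vec d → ℝ} (hf : Continuous f) :
    ∫ z, f z ∂centeredLaw q0 t x = ∫ θ, f ((Real.exp (-t) / (1 - Real.exp (-2 * t))) •
      (θ - condMean q0 t x)) ∂condMeasure q0 t x :=
  integral_map (by fun_prop) hf.aestronglyMeasurable

variable [IsProbabilityMeasure q0]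

theorem integral_weight_pos (ht : 0 < t) (x : Vec d) : 0 < ∫ θ, weight t x θ ∂q0 :=
  integral_exp_pos (integrable_weight ht x q0)

theorem lintegral_weight (ht : 0 < t) (x : Vec d) :
    ∫⁻ θ, ENNReal.ofReal (weight t x θ) ∂q0 = ENNReal.ofReal (∫ θ, weight t x θ ∂q0) :=
  (ofReal_integral_eq_lintegral_ofReal (integrable_weight ht x q0)
    (Filter.Eventually.of_forall fun θ => (weight_pos t x θ).le)).symm

theorem isProbabilityMeasure_condMeasure (ht : 0 < t) (x : Vec d) :
    IsProbabilityMeasure (condMeasure q0 t x) := by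
  constructor
  rw [condMeasure, Measure.smul_apply, withDensity_apply _ MeasurableSet.univ, setLIntegral_univ,
    smul_eq_mul]
  refine ENNReal.inv_mul_cancel ?_ ?_ <;> rw [lintegral_weight ht]
  · simpa using integral_weight_pos ht x
  · exact ENNReal.ofReal_ne_top

theorem integral_condMeasure (ht : 0 < t) (x : Vec d) (f : Vec d → ℝ) :
    ∫ θ, f θ ∂condMeasure q0 t x =
      (∫ θ, weight t x θ ∂q0)⁻¹ * ∫ θ, weight t x θ * f θ ∂q0 := by
  rw [condMeasure, integral_smul_measure, integral_withDensity_eq_integral_toReal_smul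
    (measurable_ofReal_weight t x) (Filter.Eventually.of_forall fun _ => ENNReal.ofReal_lt_top),
    lintegral_weight ht, ENNReal.toReal_inv, ENNReal.toReal_ofReal (integral_weight_pos ht x).le]
  simp [ENNReal.toReal_ofReal (weight_pos t x _).le]

theorem weight_mul_exp_norm_le (ht : 0 < t) (x θ : Vec d) (R : ℝ) :
    weight t x θ * Real.exp (R * ‖θ‖) ≤
      Real.exp ((|R| / Real.exp (-t)) ^ 2 * (1 - Real.exp (-2 * t)) / 2 +
        |R| / Real.exp (-t) * ‖x‖) := by
  have hs := one_sub_exp_pos ht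
  rw [weight, ← Real.exp_add, Real.exp_le_exp]
  set s := 1 - Real.exp (-2 * t)
  set r := Real.exp (-t)
  have hr : 0 < r := Real.exp_pos _
  set u := ‖x - r • θ‖
  set K := |R| / r
  have hK : 0 ≤ K := by positivity
  have hθ : r * ‖θ‖ ≤ u + ‖x‖ := by
    calc r * ‖θ‖ = ‖x - (x - r • θ)‖ := by
          rw [sub_sub_cancel, norm_smul, Real.norm_of_nonneg hr.le]
      _ ≤ ‖x‖ + u := norm_sub_le _ _
      _ = _ := add_comm _ _
  have h1 : R * ‖θ‖ ≤ K * (u + ‖x‖) := by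
    calc R * ‖θ‖ ≤ |R| * ‖θ‖ := by gcongr; exact le_abs_self R
      _ = K * (r * ‖θ‖) := by simp only [K]; field_simp
      _ ≤ _ := by gcongr
  have h2 : -u ^ 2 / (2 * s) + K * u ≤ K ^ 2 * s / 2 := by
    have : K ^ 2 * s / 2 - (-u ^ 2 / (2 * s) + K * u) = (u - K * s) ^ 2 / (2 * s) := by
      field_simp
      ring
    have h3 : 0 ≤ (u - K * s) ^ 2 / (2 * s) := by positivity
    linarith
  linarith

theorem integrable_exp_norm_condMeasure (ht : 0 < t) (x : Vec d) (R : ℝ) :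
    Integrable (fun θ => Real.exp (R * ‖θ‖)) (condMeasure q0 t x) := by
  refine Integrable.smul_measure ?_ ?_
  · rw [integrable_withDensity_iff_integrable_smul' (measurable_ofReal_weight t x)
      (Filter.Eventually.of_forall fun _ => ENNReal.ofReal_lt_top)]
    simp_rw [ENNReal.toReal_ofReal (weight_pos t x _).le, smul_eq_mul]
    refine Integrable.of_bound ?_ (Real.exp ((|R| / Real.exp (-t)) ^ 2 *
      (1 - Real.exp (-2 * t)) / 2 + |R| / Real.exp (-t) * ‖x‖))
      (Filter.Eventually.of_forall fun θ => ?_)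
    · exact ((integrable_weight ht x q0).1).mul (by fun_prop)
    · rw [Real.norm_of_nonneg (mul_pos (weight_pos t x θ) (Real.exp_pos _)).le]
      exact weight_mul_exp_norm_le ht x θ R
  · rw [lintegral_weight ht]
    simpa using integral_weight_pos ht x

theorem condMean_apply (ht : 0 < t) (x : Vec d) (i : Fin d) :
    condMean q0 t x i = ∫ θ, θ i ∂condMeasure q0 t x := by
  have hint : Integrable (fun θ : Vec d => θ) (condMeasure q0 t x) := by
    refine (integrable_exp_norm_condMeasure ht x 1).mono' (by fun_prop)
      (Filter.Eventually.of_forall fun θ => ?_)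
    rw [one_mul]
    exact norm_le_exp_norm θ
  exact ((EuclideanSpace.proj i : Vec d →L[ℝ] ℝ).integral_comp_comm hint).symm

theorem isProbabilityMeasure_centeredLaw (ht : 0 < t) (x : Vec d) :
    IsProbabilityMeasure (centeredLaw q0 t x) := by
  have := isProbabilityMeasure_condMeasure (q0 := q0) ht x
  exact Measure.isProbabilityMeasure_map (by fun_prop)

theorem integrable_exp_norm_centeredLaw (ht : 0 < t) (x : Vec d) (R : ℝ) :
    Integrable (fun z => Real.exp (R * ‖z‖)) (centeredLaw q0 t x) := by
  rw [centeredLaw, integrable_map_measure (by fun_prop) (by fun_prop)]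
  set a := Real.exp (-t) / (1 - Real.exp (-2 * t))
  set m := condMean q0 t x
  refine ((integrable_exp_norm_condMeasure ht x (|R| * |a|)).const_mul
    (Real.exp (|R| * |a| * ‖m‖))).mono' (by fun_prop) (Filter.Eventually.of_forall fun θ => ?_)
  rw [Function.comp_apply, Real.norm_of_nonneg (Real.exp_pos _).le, ← Real.exp_add,
    Real.exp_le_exp, norm_smul, Real.norm_eq_abs]
  calc R * (|a| * ‖θ - m‖) ≤ |R| * (|a| * (‖θ‖ + ‖m‖)) := by
        gcongr
        · exact le_abs_self R
        · exact norm_sub_le _ _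
    _ = _ := by ring

theorem integral_coord_centeredLaw (ht : 0 < t) (x : Vec d) (i : Fin d) :
    ∫ z, z i ∂centeredLaw q0 t x = 0 := by
  have := isProbabilityMeasure_condMeasure (q0 := q0) ht x
  have hint : Integrable (fun θ : Vec d => θ i) (condMeasure q0 t x) := by
    refine (integrable_exp_norm_condMeasure ht x 1).mono' (by fun_prop)
      (Filter.Eventually.of_forall fun θ => ?_)
    rw [one_mul]
    exact (PiLp.norm_apply_le θ i).trans (norm_le_exp_norm θ)
  rw [integral_centeredLaw x (by fun_prop)]
  simp only [PiLp.smul_apply, PiLp.sub_apply, smul_eq_mul]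
  rw [integral_const_mul, integral_sub hint (integrable_const _), ← condMean_apply ht]
  simp

theorem weight_eq_mul_exp_inner (ht : 0 < t) (x y m θ : Vec d) :
    weight t y θ =
      Real.exp (‖x‖ ^ 2 / (2 * (1 - Real.exp (-2 * t))) -
          Real.exp (-t) / (1 - Real.exp (-2 * t)) * ⟪m, x⟫ +
        ⟪(Real.exp (-t) / (1 - Real.exp (-2 * t))) • m, y⟫ -
        (2 * (1 - Real.exp (-2 * t)))⁻¹ * ‖y‖ ^ 2) *
      (weight t x θ *
        Real.exp ⟪y - x, (Real.exp (-t) / (1 - Real.exp (-2 * t))) • (θ - m)⟫) := by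
  have hs := one_sub_exp_pos ht
  rw [weight, weight, ← Real.exp_add, ← Real.exp_add, Real.exp_eq_exp, norm_sub_sq_real,
    norm_sub_sq_real]
  simp only [inner_smul_left, inner_smul_right, inner_sub_left, inner_sub_right, norm_smul,
    real_inner_comm m, RCLike.conj_to_real]
  field_simp
  ring

theorem integral_weight_eq_tiltedMoment (ht : 0 < t) (x y : Vec d) :
    ∫ θ, weight t y θ ∂q0 = (∫ θ, weight t x θ ∂q0) *
      Real.exp (‖x‖ ^ 2 / (2 * (1 - Real.exp (-2 * t))) -
          Real.exp (-t) / (1 - Real.exp (-2 * t)) * ⟪condMean q0 t x, x⟫ +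
        ⟪(Real.exp (-t) / (1 - Real.exp (-2 * t))) • condMean q0 t x, y⟫ -
        (2 * (1 - Real.exp (-2 * t)))⁻¹ * ‖y‖ ^ 2) *
      tiltedMoment (centeredLaw q0 t x) x [] y := by
  have h0 := (integral_weight_pos (q0 := q0) ht x).ne'
  have h : tiltedMoment (centeredLaw q0 t x) x [] y =
      ∫ z, Real.exp ⟪y - x, z⟫ ∂centeredLaw q0 t x := by
    simp [tiltedMoment, monomialAt]
  rw [h, integral_centeredLaw x (by fun_prop), integral_condMeasure ht]
  simp_rw [weight_eq_mul_exp_inner ht x y (condMean q0 t x)]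
  rw [integral_const_mul]
  field_simp

end CondMeasure

/-- **Lemma (fourth derivative of the log-density).** If `q0` has finite fourth moment then for
`t > 0`, `x ∈ ℝ^d` and indices `i₁ i₂ i₃ i₄` (given by `idx : Fin 4 → Fin d`),
`∇_x⁴ log q_t(x) = (λ_t⁴/σ_t⁸)(E_{t,x}[(θ-m)^{⊗4}] - T(C_t(x)^{⊗2}))`, where the symmetrization
`T(C^{⊗2})` has entries `C_{i₁i₂}C_{i₃i₄} + C_{i₁i₃}C_{i₂i₄} + C_{i₁i₄}C_{i₂i₃}`. -/
theorem fourth_deriv_log_density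
    {d : ℕ} (hd : 1 ≤ d) (q0 : Measure (Vec d)) [IsProbabilityMeasure q0]
    (ρ : ℝ → Vec d → ℝ)
    (hρ : ∀ u, 0 < u → forwardLaw q0 u = volume.withDensity fun x => ENNReal.ofReal (ρ u x))
    (hρpos : ∀ u, 0 < u → ∀ x, 0 < ρ u x)
    (hρsmooth : ∀ u, 0 < u → ContDiff ℝ (⊤ : ℕ∞) (ρ u))
    (hmom : Integrable (fun θ => ‖θ‖^4) q0)
    (t : ℝ) (ht : 0 < t) (x : Vec d) (idx : Fin 4 → Fin d) :
    pd (idx 0) (pd (idx 1) (pd (idx 2) (pd (idx 3) (fun y => Real.log (ρ t y))))) x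
      = Real.exp (-t)^4 / (1 - Real.exp (-2*t))^4
        * ((∫ θ, (θ (idx 0) - condMean q0 t x (idx 0)) * (θ (idx 1) - condMean q0 t x (idx 1))
              * (θ (idx 2) - condMean q0 t x (idx 2)) * (θ (idx 3) - condMean q0 t x (idx 3))
              ∂(condMeasure q0 t x))
          - ((∫ θ, (θ (idx 0) - condMean q0 t x (idx 0)) * (θ (idx 1) - condMean q0 t x (idx 1))
                ∂(condMeasure q0 t x))
              * (∫ θ, (θ (idx 2) - condMean q0 t x (idx 2))
                  * (θ (idx 3) - condMean q0 t x (idx 3)) ∂(condMeasure q0 t x))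
            + (∫ θ, (θ (idx 0) - condMean q0 t x (idx 0)) * (θ (idx 2) - condMean q0 t x (idx 2))
                ∂(condMeasure q0 t x))
              * (∫ θ, (θ (idx 1) - condMean q0 t x (idx 1))
                  * (θ (idx 3) - condMean q0 t x (idx 3)) ∂(condMeasure q0 t x))
            + (∫ θ, (θ (idx 0) - condMean q0 t x (idx 0)) * (θ (idx 3) - condMean q0 t x (idx 3))
                ∂(condMeasure q0 t x))
              * (∫ θ, (θ (idx 1) - condMean q0 t x (idx 1))
                  * (θ (idx 2) - condMean q0 t x (idx 2)) ∂(condMeasure q0 t x)))) := by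
  have := isProbabilityMeasure_centeredLaw (q0 := q0) ht x
  have hν := integrable_exp_norm_centeredLaw (q0 := q0) ht x
  have hmean := integral_coord_centeredLaw (q0 := q0) ht x
  have hs := one_sub_exp_pos ht
  have hlog : (fun y => Real.log (ρ t y)) = fun y =>
      (Real.log ((√(2 * π * (1 - Real.exp (-2 * t))))⁻¹ ^ d * ∫ θ, weight t x θ ∂q0) +
        (‖x‖ ^ 2 / (2 * (1 - Real.exp (-2 * t))) -
          Real.exp (-t) / (1 - Real.exp (-2 * t)) * ⟪condMean q0 t x, x⟫)) +
        ⟪(Real.exp (-t) / (1 - Real.exp (-2 * t))) • condMean q0 t x, y⟫ -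
        (2 * (1 - Real.exp (-2 * t)))⁻¹ * ‖y‖ ^ 2 +
        Real.log (tiltedMoment (centeredLaw q0 t x) x [] y) := by
    ext y
    have hc : (√(2 * π * (1 - Real.exp (-2 * t))))⁻¹ ^ d ≠ 0 := by positivity
    have hZ := (integral_weight_pos (q0 := q0) ht x).ne'
    rw [density_eq_integral_weight q0 ht (hρpos t ht) (hρsmooth t ht).continuous (hρ t ht) y,
      integral_weight_eq_tiltedMoment ht x y, ← mul_assoc, ← mul_assoc,
      Real.log_mul (mul_ne_zero (mul_ne_zero hc hZ) (Real.exp_pos _).ne')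
        (tiltedMoment_nil_pos hν x y).ne',
      Real.log_mul (mul_ne_zero hc hZ) (Real.exp_pos _).ne', Real.log_exp]
    ring
  rw [hlog, pd_four_log_tiltedMoment hν hmean]
  have h2 : ∀ i j : Fin d, ∫ z, z i * z j ∂centeredLaw q0 t x =
      (Real.exp (-t) / (1 - Real.exp (-2 * t))) ^ 2 *
        ∫ θ, (θ i - condMean q0 t x i) * (θ j - condMean q0 t x j) ∂condMeasure q0 t x := by
    intro i j
    rw [integral_centeredLaw x (by fun_prop), ← integral_const_mul]
    refine integral_congr_ae (Filter.Eventually.of_forall fun θ => ?_)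
    simp only [PiLp.smul_apply, PiLp.sub_apply, smul_eq_mul]
    ring
  have h4 : ∀ i j k l : Fin d, ∫ z, z i * z j * z k * z l ∂centeredLaw q0 t x =
      (Real.exp (-t) / (1 - Real.exp (-2 * t))) ^ 4 *
        ∫ θ, (θ i - condMean q0 t x i) * (θ j - condMean q0 t x j) *
          (θ k - condMean q0 t x k) * (θ l - condMean q0 t x l) ∂condMeasure q0 t x := by
    intro i j k l
    rw [integral_centeredLaw x (by fun_prop), ← integral_const_mul]
    refine integral_congr_ae (Filter.Eventually.of_forall fun θ => ?_)
    simp only [PiLp.smul_apply, PiLp.sub_apply, smul_eq_mul]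
    ring
  rw [h4]
  simp only [h2]
  rw [div_pow, div_pow]
  field_simp

end
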